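/- Let 0 < m < 1. Then there exists no function F:[0,∞)→ℝ which is Lipschitz continuous, sublinear, satisfies 0 ≤ F(x) ≤ m·x for all x ≥ 0, and is a viscosity solution of the stationary equation (E) on (0,∞). -/

import Mathlib

open Set Filter

/-- A function `ψ : [0,∞) → ℝ` is sublinear if `ψ(x)/x → 0` as `x → ∞`. -/
def Sublinear (ψ : ℝ → ℝ) : Prop :=
  Tendsto (fun x => ψ x / x) atTop (nhds 0)

/-- Viscosity subsolution of the stationary equation (E):
`(1/2)(F′ − m)(F′ − m − 1) + F/x − m = 0` on `(0,∞)`. -/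
def IsSubsolutionE (m : ℝ) (F : ℝ → ℝ) : Prop :=
  ∀ φ : ℝ → ℝ, ContDiff ℝ 1 φ →
    ∀ x₀ : ℝ, 0 < x₀ →
      IsLocalMaxOn (fun x => F x - φ x) (Ici 0) x₀ →
      (1 / 2) * (deriv φ x₀ - m) * (deriv φ x₀ - m - 1) + F x₀ / x₀ - m ≤ 0

/-- Viscosity supersolution of the stationary equation (E). -/
def IsSupersolutionE (m : ℝ) (F : ℝ → ℝ) : Prop :=
  ∀ φ : ℝ → ℝ, ContDiff ℝ 1 φ →
    ∀ x₀ : ℝ, 0 < x₀ →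
      IsLocalMinOn (fun x => F x - φ x) (Ici 0) x₀ →
      (1 / 2) * (deriv φ x₀ - m) * (deriv φ x₀ - m - 1) + F x₀ / x₀ - m ≥ 0

/-- Viscosity solution of the stationary equation (E). -/
def IsSolutionE (m : ℝ) (F : ℝ → ℝ) : Prop :=
  IsSubsolutionE m F ∧ IsSupersolutionE m F

/-- Proposition 4.2, non-existence of sublinear equilibria for `0 < m < 1`.
For `0 < m < 1`, there is no Lipschitz, sublinear viscosity solution `F` of (E)
with `0 ≤ F(x) ≤ m·x` for all `x ≥ 0`. -/
theorem no_sublinear_equilibrium (m : ℝ) (hm₀ : 0 < m) (hm₁ : m < 1) :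
    ¬ ∃ F : ℝ → ℝ,
        (∃ K : NNReal, LipschitzOnWith K F (Ici 0)) ∧
        Sublinear F ∧
        (∀ x : ℝ, 0 ≤ x → 0 ≤ F x ∧ F x ≤ m * x) ∧
        IsSolutionE m F := by
  rintro ⟨F, ⟨K, hLip⟩, hsub, hbd, -, hsuper⟩
  have hmm : 0 < m * (1 - m) := mul_pos hm₀ (by linarith)
  set δ := m * (1 - m) / 8 with hδ
  have hδ0 : 0 < δ := by positivity
  have hδ1 : δ ≤ 1 := by nlinarith
  obtain ⟨R, hR0, hR⟩ : ∃ R : ℝ, 0 < R ∧ ∀ x, R ≤ x → F x / x < δ / 8 := by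
    have h := hsub.eventually (gt_mem_nhds (show (0 : ℝ) < δ / 8 by positivity))
    obtain ⟨R, h⟩ := eventually_atTop.1 h
    exact ⟨max R 1, by positivity, fun x hx => h x ((le_max_left _ _).trans hx)⟩
  -- Touch `F` from below on `[R, 3R]` by a concave parabola with slopes at most `δ`.
  set a := δ / (2 * R) with ha
  have haR : a * R = δ / 2 := by rw [ha]; field_simp
  have ha0 : 0 < a := by positivity
  let φ : ℝ → ℝ := fun x => -a * (x - 2 * R) ^ 2
  have hφ : ContDiff ℝ 1 φ := by fun_prop
  have hsubset : Icc R (3 * R) ⊆ Ici 0 := fun x hx => hR0.le.trans hx.1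
  obtain ⟨x₀, hx₀, hmin⟩ := isCompact_Icc.exists_isMinOn
    (nonempty_Icc.2 (by linarith : R ≤ 3 * R))
    ((hLip.continuousOn.mono hsubset).sub hφ.continuous.continuousOn)
  have hmid : F x₀ - φ x₀ ≤ F (2 * R) := by
    simpa [φ] using hmin (show 2 * R ∈ Icc R (3 * R) from ⟨by linarith, by linarith⟩)
  have hval : F (2 * R) < δ * R / 4 := by
    have h := hR (2 * R) (by linarith)
    rw [div_lt_iff₀ (by positivity)] at h
    linarith
  have hpos : 0 < x₀ := hR0.trans_le hx₀.1
  have hF₀ := (hbd x₀ hpos.le).1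
  have hsq : a * (x₀ - 2 * R) ^ 2 < a * R ^ 2 := by
    have : a * R ^ 2 = δ * R / 2 := by rw [pow_two, ← mul_assoc, haR]; ring
    have := mul_pos hδ0 hR0
    simp only [φ] at hmid
    linarith
  obtain ⟨hlo, hhi⟩ := abs_lt_of_sq_lt_sq' (lt_of_mul_lt_mul_left hsq ha0.le) hR0.le
  have hloc : IsLocalMinOn (fun x => F x - φ x) (Ici 0) x₀ :=
    (hmin.isLocalMin (Icc_mem_nhds (by linarith) (by linarith))).on _
  have hderiv : deriv φ x₀ = -(2 * a * (x₀ - 2 * R)) := by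
    have h : HasDerivAt φ _ x₀ :=
      (((hasDerivAt_id x₀).sub_const (2 * R)).pow 2).const_mul (-a)
    rw [h.deriv]
    simp
    ring
  have hp : |deriv φ x₀| ≤ δ := by
    rw [hderiv, abs_neg, abs_le]
    constructor <;> nlinarith
  have hE := hsuper φ hφ x₀ hpos hloc
  have hu := hR x₀ hx₀.1
  obtain ⟨hp1, hp2⟩ := abs_le.1 hp
  generalize deriv φ x₀ = p at *
  have hpp : p ^ 2 ≤ δ := by nlinarith
  have hpm : -(p * (2 * m + 1)) ≤ 3 * δ := by nlinarith
  nlinarith
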